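/- arXiv:2204.04255 — 2 statements merged into one kernel-verified Lean document; each statement's English description precedes it below -/
import Mathlib

section
/- Let R = [r] × [s], let x ∈ ℝ_{>0}^R, let y = φ⁻¹(x), and fix (i,j) ∈ R. Then for every integer k, ρ^{k}(y)_{ij} · ρ^{k−i−j+1}(y)_{r+1−i, s+1−j} = 1, where ρ^k denotes the k-th iterate of birational rowmotion (negative powers being iterates of the inverse). -/
namespace Paper

/-- Membership in the rectangle poset `R = [1,r] × [1,s]` (coordinates in `ℤ`). -/
def inR (r s : ℕ) (p : ℤ × ℤ) : Prop :=
  1 ≤ p.1 ∧ p.1 ≤ (r : ℤ) ∧ 1 ≤ p.2 ∧ p.2 ≤ (s : ℤ)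

instance (r s : ℕ) : DecidablePred (inR r s) := fun _ => by unfold inR; infer_instance

/-- The cover relation in the product of two chains. -/
def CoverStep (p q : ℤ × ℤ) : Prop :=
  (q.1 = p.1 + 1 ∧ q.2 = p.2) ∨ (q.1 = p.1 ∧ q.2 = p.2 + 1)

/-- Upper covers of `p` inside the rectangle. -/
def upSet (r s : ℕ) (p : ℤ × ℤ) : Finset (ℤ × ℤ) :=
  ({(p.1 + 1, p.2), (p.1, p.2 + 1)} : Finset (ℤ × ℤ)).filter (inR r s)

/-- Lower covers of `p` inside the rectangle. -/
def downSet (r s : ℕ) (p : ℤ × ℤ) : Finset (ℤ × ℤ) :=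
  ({(p.1 - 1, p.2), (p.1, p.2 - 1)} : Finset (ℤ × ℤ)).filter (inR r s)

/-- Sum of the labels of the lower covers of `p` (empty sum = 1). -/
noncomputable def dsum (r s : ℕ) (x : ℤ × ℤ → ℝ) (p : ℤ × ℤ) : ℝ :=
  if (downSet r s p).Nonempty then ∑ q ∈ downSet r s p, x q else 1

/-- Parallel sum of the labels of the upper covers of `p` (empty parallel sum = 1). -/
noncomputable def usum (r s : ℕ) (x : ℤ × ℤ → ℝ) (p : ℤ × ℤ) : ℝ :=
  if (upSet r s p).Nonempty then (∑ q ∈ upSet r s p, (x q)⁻¹)⁻¹ else 1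

/-- The birational toggle at `p`. -/
noncomputable def toggle (r s : ℕ) (p : ℤ × ℤ) (x : ℤ × ℤ → ℝ) : ℤ × ℤ → ℝ :=
  fun q => if q = p then usum r s x p * dsum r s x p / x p else x q

/-- The elements of `[1,a] × [1,b]` listed from top to bottom
(descending lexicographic order, the reverse of a linear extension). -/
def rectList (a b : ℕ) : List (ℤ × ℤ) :=
  (List.range a).reverse.flatMap fun i =>
    (List.range b).reverse.map fun j => ((i : ℤ) + 1, (j : ℤ) + 1)

/-- Birational rowmotion on the rectangle: toggles from top to bottom. -/
noncomputable def rho (r s : ℕ) (x : ℤ × ℤ → ℝ) : ℤ × ℤ → ℝ :=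
  (rectList r s).foldl (fun y p => toggle r s p y) x

/-- Inverse birational rowmotion: toggles from bottom to top. -/
noncomputable def rhoInv (r s : ℕ) (x : ℤ × ℤ → ℝ) : ℤ × ℤ → ℝ :=
  (rectList r s).reverse.foldl (fun y p => toggle r s p y) x

/-- Integer powers of birational rowmotion. -/
noncomputable def rhoPow (r s : ℕ) (k : ℤ) (x : ℤ × ℤ → ℝ) : ℤ × ℤ → ℝ :=
  if 0 ≤ k then (rho r s)^[k.toNat] x else (rhoInv r s)^[(-k).toNat] x

/-- Saturated chains from `a` to `b`, as lists of successive cover steps. -/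
def ChainList (a b : ℤ × ℤ) : Type :=
  {l : List (ℤ × ℤ) // l.Chain' CoverStep ∧ l.head? = some a ∧ l.getLast? = some b}

/-- The inverse birational transfer map on the rectangle: `φ⁻¹(x)_p` is the total weight
of all saturated chains from the minimal element `(1,1)` to `p`. -/
noncomputable def phiInv (x : ℤ × ℤ → ℝ) : ℤ × ℤ → ℝ :=
  fun p => ∑ᶠ c : ChainList (1, 1) p, (c.1.map x).prod

/-- The birational transfer map `φ(x)_p = x_p / ∑_{q ⋖ p} x_q`. -/
noncomputable def phi (r s : ℕ) (x : ℤ × ℤ → ℝ) : ℤ × ℤ → ℝ :=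
  fun p => x p / dsum r s x p

/-- A collection of `k` pairwise vertex-disjoint lattice paths in the interval
`[i₁,i₂] × [j₁,j₂]`, from `(i₁,j₁),…,(i₁,j₁+k-1)` to `(i₂,j₂-k+1),…,(i₂,j₂)`. -/
structure RSys (i₁ i₂ j₁ j₂ : ℤ) (k : ℕ) where
  path : Fin k → List (ℤ × ℤ)
  chain : ∀ t, (path t).Chain' CoverStep
  mem : ∀ t, ∀ v ∈ path t, i₁ ≤ v.1 ∧ v.1 ≤ i₂ ∧ j₁ ≤ v.2 ∧ v.2 ≤ j₂
  first : ∀ t : Fin k, (path t).head? = some (i₁, j₁ + ((t : ℕ) : ℤ))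
  final : ∀ t : Fin k, (path t).getLast? = some (i₂, j₂ - k + 1 + ((t : ℕ) : ℤ))
  disjoint : ∀ t t' : Fin k, t ≠ t' → ∀ v ∈ path t, v ∉ path t'

/-- The weight of a collection of paths: the product of labels of all its elements. -/
noncomputable def RSysWeight (x : ℤ × ℤ → ℝ) {i₁ i₂ j₁ j₂ : ℤ} {k : ℕ}
    (L : RSys i₁ i₂ j₁ j₂ k) : ℝ :=
  ∏ t : Fin k, ((L.path t).map x).prod

/-- `w_I^{(k)}(x)`: total weight of all collections of `k` nonintersecting paths in the
interval `I = [i₁,i₂] × [j₁,j₂]` (with `w_I^{(0)} = 1`). -/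
noncomputable def w (i₁ i₂ j₁ j₂ : ℤ) (k : ℤ) (x : ℤ × ℤ → ℝ) : ℝ :=
  if k ≤ 0 then 1 else ∑ᶠ L : RSys i₁ i₂ j₁ j₂ k.toNat, RSysWeight x L

/-- `w_I(x)`: the product of all labels in the interval `I = [i₁,i₂] × [j₁,j₂]`. -/
noncomputable def wProd (i₁ i₂ j₁ j₂ : ℤ) (x : ℤ × ℤ → ℝ) : ℝ :=
  ∏ p ∈ Finset.Icc i₁ i₂ ×ˢ Finset.Icc j₁ j₂, x p

/-- The directed edges of the graph `𝒢_R` on vertex set `[1,r+1] × [1,s]`: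
`(i,j) → (i+1,j)` for `(i,j) ∈ R`, and `(i,j) → (i+1,j-1)` when valid. -/
def GEdge (r s : ℕ) (p q : ℤ × ℤ) : Prop :=
  1 ≤ p.1 ∧ p.1 ≤ (r : ℤ) ∧ 1 ≤ p.2 ∧ p.2 ≤ (s : ℤ) ∧ q.1 = p.1 + 1 ∧
    (q.2 = p.2 ∨ (q.2 = p.2 - 1 ∧ 2 ≤ p.2))

/-- The weight of an edge of `𝒢_R`: `x_p⁻¹` for vertical edges, `1` for diagonal ones. -/
noncomputable def edgeWt (x : ℤ × ℤ → ℝ) (p q : ℤ × ℤ) : ℝ :=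
  if q.2 = p.2 then (x p)⁻¹ else 1

/-- The weight of a directed path in `𝒢_R`, given as its list of vertices. -/
noncomputable def listWt (x : ℤ × ℤ → ℝ) (l : List (ℤ × ℤ)) : ℝ :=
  ((l.zip l.tail).map fun e => edgeWt x e.1 e.2).prod

/-- The boundary vertex `P_t` of `𝒢_R`: `P_j = (1,j)` for `1 ≤ j ≤ s`, `P_{s+i} = (i+1,s)`. -/
def Pvert (s : ℕ) (t : ℤ) : ℤ × ℤ := if t ≤ (s : ℤ) then (1, t) else (t - s + 1, (s : ℤ))

/-- The boundary vertex `Q_t` of `𝒢_R`: `Q_i = (i,1)` for `1 ≤ i ≤ r`, `Q_{r+j} = (r+1,j)`. -/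
def Qvert (r : ℕ) (t : ℤ) : ℤ × ℤ := if t ≤ (r : ℤ) then (t, 1) else ((r : ℤ) + 1, t - r)

/-- A collection of `k` pairwise vertex-disjoint directed paths in `𝒢_R` from
`{P_i, …, P_{i+k-1}}` to `{Q_j, …, Q_{j+k-1}}`. -/
structure GSys (r s : ℕ) (i j : ℤ) (k : ℕ) where
  perm : Equiv.Perm (Fin k)
  path : Fin k → List (ℤ × ℤ)
  chain : ∀ t, (path t).Chain' (GEdge r s)
  first : ∀ t : Fin k, (path t).head? = some (Pvert s (i + ((t : ℕ) : ℤ)))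
  final : ∀ t : Fin k, (path t).getLast? = some (Qvert r (j + (((perm t) : ℕ) : ℤ)))
  disjoint : ∀ t t' : Fin k, t ≠ t' → ∀ v ∈ path t, v ∉ path t'

/-- The weight of a collection of paths in `𝒢_R`: the product of the weights of all
edges used. -/
noncomputable def GSysWeight (x : ℤ × ℤ → ℝ) {r s : ℕ} {i j : ℤ} {k : ℕ}
    (L : GSys r s i j k) : ℝ :=
  ∏ t : Fin k, listWt x (L.path t)

/-- `W_{ij}^{(k)}(x)`: total weight of all collections of `k` nonintersecting paths in
`𝒢_R` from `{P_i,…,P_{i+k-1}}` to `{Q_j,…,Q_{j+k-1}}`; `W_{ij}^{(0)} = 1`, and `0` when an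
out-of-range index occurs. -/
noncomputable def W (r s : ℕ) (x : ℤ × ℤ → ℝ) (i j k : ℤ) : ℝ :=
  if k < 0 then 0
  else if k = 0 then 1
  else if 1 ≤ i ∧ 1 ≤ j ∧ i + k - 1 ≤ (r : ℤ) + s ∧ j + k - 1 ≤ (r : ℤ) + s then
    ∑ᶠ L : GSys r s i j k.toNat, GSysWeight x L
  else 0


/-- The total weight, with vertex weights `D`, of the lattice paths from the border vertex `(i, 0)`
to `(m, j)` that leave the border at once. -/
noncomputable def pathSum (D : ℕ → ℕ → ℝ) (i : ℕ) : ℕ → ℕ → ℝ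
  | 0, _ => 0
  | m + 1, 0 => if m + 1 = i then 1 else 0
  | m + 1, j + 1 => D (m + 1) (j + 1) * (pathSum D i m (j + 1) + pathSum D i (m + 1) j)

/-- A rowmotion orbit on `[r] × [s]` indexed by time: `A t` is the labeling at time `t` and `B t` its
inverse, both extended to the border. The value `1` is put at `(1, 0)` for `A` and at `(r, s + 1)`
for `B`, so that the boundary conventions of the toggles are built into the recurrence `step`. -/
structure RowmotionOrbit (r s : ℕ) (A B : ℤ → ℕ → ℕ → ℝ) : Prop where
  pos : ∀ t m j, 1 ≤ m → m ≤ r → 1 ≤ j → j ≤ s → 0 < A t m j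
  mul_eq_one : ∀ t m j, 1 ≤ m → m ≤ r → 1 ≤ j → j ≤ s → A t m j * B t m j = 1
  lower_row : ∀ t j, A t 0 j = 0
  lower_col : ∀ t m, A t m 0 = if m = 1 then 1 else 0
  upper_row : ∀ t j, B t (r + 1) j = 0
  upper_col : ∀ t m, B t m (s + 1) = if m = r then 1 else 0
  step : ∀ t m j, m < r → j < s →
    A (t + 1) (m + 1) (j + 1) * (B (t + 1) (m + 2) (j + 1) + B (t + 1) (m + 1) (j + 2)) =
      B t (m + 1) (j + 1) * (A t m (j + 1) + A t (m + 1) j)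

/-- The quotient of a label by the sum of the labels below it. -/
noncomputable def slack (a : ℕ → ℕ → ℝ) (m j : ℕ) : ℝ := a m j / (a (m - 1) j + a m (j - 1))

/-- The total flow from column `j` to column `j + 1` through the first `m` rows, when the step from
`(n, j)` to `(n, j + 1)` carries `F n j * b n (j + 1)`. -/
noncomputable def flow (F b : ℕ → ℕ → ℝ) (m j : ℕ) : ℝ :=
  ∑ n ∈ Finset.range m, F (n + 1) j * b (n + 1) (j + 1)

theorem flow_zero (D b : ℕ → ℕ → ℝ) (i m : ℕ) (hi : 1 ≤ i) :
    flow (pathSum D i) b m 0 = if i ≤ m then b i 1 else 0 := by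
  induction m with
  | zero => simp [flow]; lia
  | succ m ih =>
    rw [flow, Finset.sum_range_succ, ← flow, ih, pathSum]
    rcases lt_trichotomy i (m + 1) with hlt | rfl | hgt
    · rw [if_pos (by lia), if_neg (by lia), if_pos (by lia)]; ring
    · simp
    · rw [if_neg (by lia), if_neg (by lia), if_neg (by lia)]; ring

namespace RowmotionOrbit

variable {r s : ℕ} {A B : ℤ → ℕ → ℕ → ℝ}

theorem nonneg (h : RowmotionOrbit r s A B) (t : ℤ) (m j : ℕ) (hm : m ≤ r) (hj : j ≤ s) :
    0 ≤ A t m j := by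
  rcases Nat.eq_zero_or_pos m with rfl | hm'
  · rw [h.lower_row]
  rcases Nat.eq_zero_or_pos j with rfl | hj'
  · rw [h.lower_col]; split_ifs <;> norm_num
  · exact (h.pos t m j hm' hm hj' hj).le

theorem lower_sum_pos (h : RowmotionOrbit r s A B) (t : ℤ) (m j : ℕ) (hm : m < r) (hj : j < s) :
    0 < A t m (j + 1) + A t (m + 1) j := by
  rcases Nat.eq_zero_or_pos m with rfl | hm'
  · rcases Nat.eq_zero_or_pos j with rfl | hj'
    · simp [h.lower_row, h.lower_col]
    · rw [h.lower_row, zero_add]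
      exact h.pos t _ _ (by lia) (by lia) (by lia) (by lia)
  · exact add_pos_of_pos_of_nonneg (h.pos t _ _ (by lia) (by lia) (by lia) (by lia))
      (h.nonneg t _ _ (by lia) (by lia))

theorem pathSum_slack_one (h : RowmotionOrbit r s A B) (t : ℤ) (m j : ℕ) (hm : m ≤ r)
    (hj : j ≤ s) : pathSum (slack (A t)) 1 m j = A t m j := by
  induction m generalizing j with
  | zero => simp [pathSum, h.lower_row]
  | succ m ihm =>
    induction j with
    | zero => simp [pathSum, h.lower_col]
    | succ j ihj =>
      rw [pathSum, ihm _ (by lia) hj, ihj (by lia), slack]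
      have := h.lower_sum_pos t m j (by lia) (by lia)
      simp only [Nat.add_sub_cancel]
      field_simp

/-- The path sums with slack weights at time `t` satisfy the balance equation of a flow on the
labels at time `t + 1`. -/
theorem balance (h : RowmotionOrbit r s A B) (t : ℤ) (i m j : ℕ) (hm : m < r) (hj : j < s) :
    pathSum (slack (A t)) i (m + 1) (j + 1) *
        (B (t + 1) (m + 2) (j + 1) + B (t + 1) (m + 1) (j + 2)) =
      B (t + 1) (m + 1) (j + 1) *
        (pathSum (slack (A t)) i m (j + 1) + pathSum (slack (A t)) i (m + 1) j) := by
  have h1 := h.lower_sum_pos t m j hm hj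
  have h2 := h.step t m j hm hj
  have h3 := h.mul_eq_one t (m + 1) (j + 1) (by lia) (by lia) (by lia) (by lia)
  have h4 := h.mul_eq_one (t + 1) (m + 1) (j + 1) (by lia) (by lia) (by lia) (by lia)
  rw [pathSum, slack]
  simp only [Nat.add_sub_cancel]
  generalize pathSum _ i m (j + 1) + pathSum _ i (m + 1) j = P
  generalize A t m (j + 1) + A t (m + 1) j = d at *
  generalize B (t + 1) (m + 2) (j + 1) + B (t + 1) (m + 1) (j + 2) = u at *
  field_simp
  linear_combination (P * A t (m + 1) (j + 1) * B (t + 1) (m + 1) (j + 1)) * h2 +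
    P * (B (t + 1) (m + 1) (j + 1) * d) * h3 - P * A t (m + 1) (j + 1) * u * h4

theorem flow_conservation (h : RowmotionOrbit r s A B) (t : ℤ) (i m j : ℕ) (hm : m ≤ r)
    (hj : j < s) :
    flow (pathSum (slack (A t)) i) (B (t + 1)) m j =
      flow (pathSum (slack (A t)) i) (B (t + 1)) m (j + 1) +
        pathSum (slack (A t)) i m (j + 1) * B (t + 1) (m + 1) (j + 1) := by
  induction m with
  | zero => simp [flow, pathSum]
  | succ m ih =>
    have := h.balance t i m j (by lia) hj
    have ih := ih (by lia)
    simp only [flow, Finset.sum_range_succ] at ih ⊢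
    linear_combination ih - this

theorem flow_last (h : RowmotionOrbit r s A B) (t : ℤ) (i m : ℕ) (hm : m ≤ r) (hr : 1 ≤ r) :
    flow (pathSum (slack (A t)) i) (B (t + 1)) m s =
      if m = r then pathSum (slack (A t)) i r s else 0 := by
  unfold flow
  simp only [h.upper_col]
  split_ifs with hmr
  · subst hmr
    obtain ⟨m, rfl⟩ : ∃ n, m = n + 1 := ⟨m - 1, by lia⟩
    simp
  · exact Finset.sum_eq_zero fun n hn => by
      rw [Finset.mem_range] at hn
      rw [if_neg (by lia), mul_zero]

theorem pathSum_slack_top (h : RowmotionOrbit r s A B) (t : ℤ) (i : ℕ) (hi : 1 ≤ i)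
    (hir : i ≤ r) : pathSum (slack (A t)) i r s = B (t + 1) i 1 := by
  have key : ∀ j ≤ s, flow (pathSum (slack (A t)) i) (B (t + 1)) r j = B (t + 1) i 1 := by
    intro j hj
    induction j with
    | zero => rw [flow_zero _ _ i r hi, if_pos hir]
    | succ j ih =>
      have := h.flow_conservation t i r j le_rfl (by lia)
      rw [h.upper_row, mul_zero, add_zero] at this
      rw [← this, ih (by lia)]
  rw [← key s le_rfl, h.flow_last t i r le_rfl (by lia), if_pos rfl]

theorem pathSum_slack_eq_flow (h : RowmotionOrbit r s A B) (t : ℤ) (i m j : ℕ) (hi : 1 ≤ i)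
    (hm : m < r) (hj : j < s) :
    pathSum (slack (A (t + 1))) (i + 1) (m + 1) (j + 1) =
      A (t + 1) (m + 1) (j + 1) * flow (pathSum (slack (A t)) i) (B (t + 1)) m j := by
  induction j generalizing m with
  | zero =>
    induction m with
    | zero =>
      simp [pathSum, flow]; lia
    | succ m ih =>
      have h1 := h.pos (t + 1) (m + 1) 1 (by lia) (by lia) (by lia) (by lia)
      have h2 := h.mul_eq_one (t + 1) (m + 1) 1 (by lia) (by lia) (by lia) (by lia)
      rw [pathSum, ih (by lia), flow_zero _ _ i _ hi, flow_zero _ _ i _ hi, slack, pathSum,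
        h.lower_col]
      simp only [Nat.add_sub_cancel, zero_add]
      rw [if_neg (show m + 1 + 1 ≠ 1 by lia), add_zero]
      rcases lt_trichotomy i (m + 1) with hlt | rfl | hgt
      · rw [if_pos (by lia), if_neg (by lia), if_pos (by lia)]; field_simp; ring
      · simp; field_simp; linear_combination -A (t + 1) (m + 1 + 1) 1 * h2
      · rw [if_neg (by lia), if_neg (by lia), if_neg (by lia)]; ring
  | succ j ihj =>
    induction m with
    | zero =>
      rw [pathSum, ihj 0 (by lia) (by lia)]
      simp [pathSum, flow]
    | succ m ihm =>
      have h1 := h.pos (t + 1) (m + 1) (j + 1 + 1) (by lia) (by lia) (by lia) (by lia)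
      have h2 := h.pos (t + 1) (m + 1 + 1) (j + 1) (by lia) (by lia) (by lia) (by lia)
      have h3 := h.mul_eq_one (t + 1) (m + 1) (j + 1 + 1) (by lia) (by lia) (by lia) (by lia)
      have h4 := h.mul_eq_one (t + 1) (m + 1 + 1) (j + 1) (by lia) (by lia) (by lia) (by lia)
      have h5 := h.flow_conservation t i (m + 1) j (by lia) (by lia)
      have h6 : flow (pathSum (slack (A t)) i) (B (t + 1)) (m + 1) (j + 1) =
          flow (pathSum (slack (A t)) i) (B (t + 1)) m (j + 1) +
          pathSum (slack (A t)) i (m + 1) (j + 1) * B (t + 1) (m + 1) (j + 1 + 1) := by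
        rw [flow, Finset.sum_range_succ, ← flow]
      rw [pathSum, ihm (by lia), ihj _ (by lia) (by lia), h5, h6, slack]
      simp only [Nat.add_sub_cancel]
      field_simp
      linear_combination A (t + 1) (m + 1 + 1) (j + 1 + 1) *
        pathSum (slack (A t)) i (m + 1) (j + 1) * (h4 - h3)

theorem pathSum_slack_succ (h : RowmotionOrbit r s A B) (t : ℤ) (i m : ℕ) (hi : 1 ≤ i)
    (hm : m < r) (hs : 1 ≤ s) :
    pathSum (slack (A (t + 1))) (i + 1) (m + 1) s = pathSum (slack (A t)) i m s := by
  obtain ⟨j, rfl⟩ : ∃ n, s = n + 1 := ⟨s - 1, by lia⟩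
  have h1 := h.mul_eq_one (t + 1) (m + 1) (j + 1) (by lia) (by lia) (by lia) (by lia)
  rw [h.pathSum_slack_eq_flow t i m j hi hm (by lia),
    h.flow_conservation t i m j (by lia) (by lia), h.flow_last t i m (by lia) (by lia),
    if_neg (by lia)]
  linear_combination pathSum (slack (A t)) i m (j + 1) * h1

/-- Reciprocity for the first column. -/
theorem first_col (h : RowmotionOrbit r s A B) (hs : 1 ≤ s) (t : ℤ) (i m : ℕ)
    (him : i + 1 + m = r + 1) (hm : 1 ≤ m) : B (t + i + 1) (i + 1) 1 = A t m s := by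
  have key : ∀ n m : ℕ, m + n ≤ r → pathSum (slack (A (t + n))) (n + 1) (m + n) s = A t m s := by
    intro n
    induction n with
    | zero => intro m hm; simpa using h.pathSum_slack_one t m s hm le_rfl
    | succ n ih =>
      intro m hm
      push_cast
      rw [← add_assoc, ← add_assoc, h.pathSum_slack_succ _ _ _ (by lia) (by lia) hs,
        ih m (by lia)]
  rw [← h.pathSum_slack_top (t + i) (i + 1) (by lia) (by lia), ← key i m (by lia)]
  congr 1; lia

/-- Reciprocity at a vertex, with the roles of a label and its inverse exchanged. -/
theorem reciprocity_swap (h : RowmotionOrbit r s A B) (j n : ℕ) (hjn : j + n = s + 1)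
    (hn : 1 ≤ n)
    (hj : 1 ≤ j → ∀ (t u : ℤ) (i m : ℕ), i + m = r + 1 → 1 ≤ i → u = t + i + j - 1 →
      B u i j = A t m n)
    (t u : ℤ) (i m : ℕ) (him : i + m = r + 1) (hm : 1 ≤ m) (hu : u = t + i + j - 1) :
    A u i j = B t m n := by
  rcases Nat.eq_zero_or_pos j with rfl | hj'
  · obtain rfl : n = s + 1 := by lia
    rw [h.lower_col, h.upper_col]
    exact if_congr (by lia) rfl rfl
  rcases Nat.eq_zero_or_pos i with rfl | hi
  · obtain rfl : m = r + 1 := by lia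
    rw [h.lower_row, h.upper_row]
  have h1 := h.mul_eq_one u i j hi (by lia) hj' (by lia)
  have h2 := h.mul_eq_one t m n hm (by lia) hn (by lia)
  rw [hj hj' t u i m him hi hu] at h1
  linear_combination B t m n * h1 - A u i j * h2

/-- Reciprocity in two adjacent columns, on the rectangle extended by its border. -/
theorem reciprocity_aux (h : RowmotionOrbit r s A B) (j : ℕ) (n : ℕ) (hjn : j + n = s)
    (hn : 1 ≤ n) :
    (∀ (t u : ℤ) (i m : ℕ), i + m = r + 1 → 1 ≤ i → u = t + i + j → B u i (j + 1) = A t m n) ∧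
    (∀ (t u : ℤ) (i m : ℕ), i + m = r + 1 → 1 ≤ m → u = t + i + j - 1 →
      A u i j = B t m (n + 1)) := by
  induction j generalizing n with
  | zero =>
    refine ⟨fun t u i m him hi hu => ?_, ?_⟩
    · obtain ⟨i, rfl⟩ : ∃ k, i = k + 1 := ⟨i - 1, by lia⟩
      obtain rfl : n = s := by lia
      rcases Nat.eq_zero_or_pos m with rfl | hm
      · obtain rfl : i = r := by lia
        rw [h.upper_row, h.lower_row]
      rw [← h.first_col hn t i m him hm]
      congr 1; push_cast at hu; lia
    · exact h.reciprocity_swap 0 (n + 1) (by lia) (by lia) (by lia)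
  | succ j ih =>
    obtain ⟨hB, hA⟩ := ih (n + 1) (by lia) (by lia)
    have hA' := h.reciprocity_swap (j + 1) (n + 1) (by lia) (by lia)
      (fun _ t u i m him hi hu => hB t u i m him hi (by push_cast at hu; lia))
    refine ⟨fun t u i m him hi hu => ?_, hA'⟩
    rcases Nat.eq_zero_or_pos m with rfl | hm
    · obtain rfl : i = r + 1 := by lia
      rw [h.upper_row, h.lower_row]
    obtain ⟨i, rfl⟩ : ∃ k, i = k + 1 := ⟨i - 1, by lia⟩
    obtain ⟨m, rfl⟩ : ∃ k, m = k + 1 := ⟨m - 1, by lia⟩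
    obtain ⟨v, rfl⟩ : ∃ v, u = v + 1 := ⟨u - 1, by lia⟩
    push_cast at hu
    have e1 := h.step v i j (by lia) (by lia)
    have e2 := h.step t m n (by lia) (by lia)
    rw [hB t (v + 1) (i + 2) m (by lia) (by lia) (by push_cast; lia),
      hA' (t + 1) (v + 1) (i + 1) (m + 1) (by lia) (by lia) (by push_cast; lia),
      hB t v (i + 1) (m + 1) (by lia) (by lia) (by push_cast; lia),
      hA' (t + 1) v i (m + 2) (by lia) (by lia) (by push_cast; lia),
      hA (t + 1) v (i + 1) (m + 1) (by lia) (by lia) (by push_cast; lia)] at e1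
    have h1 := h.mul_eq_one t (m + 1) (n + 1) (by lia) (by lia) (by lia) (by lia)
    have h2 := h.mul_eq_one (t + 1) (m + 1) (n + 1) (by lia) (by lia) (by lia) (by lia)
    linear_combination A (t + 1) (m + 1) (n + 1) * e1 + A t (m + 1) (n + 1) * e2
      - (A t m (n + 1) + B (v + 1) (i + 1) (j + 2)) * h2
      + (A t m (n + 1) + A t (m + 1) n) * h1

/-- Labels at antipodal vertices are inverse to each other after a suitable time shift. -/
theorem reciprocity (h : RowmotionOrbit r s A B) (i j m n : ℕ) (hi : 1 ≤ i) (hm : 1 ≤ m)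
    (hj : 1 ≤ j) (hn : 1 ≤ n) (him : i + m = r + 1) (hjn : j + n = s + 1) (t u : ℤ)
    (hu : u = t + i + j - 1) : A u i j * A t m n = 1 := by
  obtain ⟨j, rfl⟩ : ∃ k, j = k + 1 := ⟨j - 1, by lia⟩
  rw [← (h.reciprocity_aux j n (by lia) hn).1 t u i m him hi (by push_cast at hu; lia)]
  exact h.mul_eq_one u i (j + 1) hi (by lia) hj (by lia)

end RowmotionOrbit

theorem toggle_of_ne (r s : ℕ) {p q : ℤ × ℤ} (h : q ≠ p) (x : ℤ × ℤ → ℝ) :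
    toggle r s p x q = x q := if_neg h

theorem toggle_self (r s : ℕ) (p : ℤ × ℤ) (x : ℤ × ℤ → ℝ) :
    toggle r s p x p = usum r s x p * dsum r s x p / x p := if_pos rfl

theorem mem_upSet {r s : ℕ} {p q : ℤ × ℤ} : q ∈ upSet r s p ↔ CoverStep p q ∧ inR r s q := by
  simp [upSet, CoverStep, Prod.ext_iff]

theorem mem_downSet {r s : ℕ} {p q : ℤ × ℤ} : q ∈ downSet r s p ↔ CoverStep q p ∧ inR r s q := by
  simp only [downSet, CoverStep, Prod.ext_iff, Finset.mem_filter, Finset.mem_insert,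
    Finset.mem_singleton]
  refine and_congr_left fun _ => or_congr ?_ ?_ <;> constructor <;> rintro ⟨h₁, h₂⟩ <;>
    constructor <;> lia

theorem CoverStep.ne {p q : ℤ × ℤ} (h : CoverStep p q) : p ≠ q := by
  rintro rfl
  rcases h with h | h <;> lia

theorem usum_congr {r s : ℕ} {x y : ℤ × ℤ → ℝ} {p : ℤ × ℤ}
    (h : ∀ q, CoverStep p q → x q = y q) : usum r s x p = usum r s y p := by
  unfold usum
  rw [Finset.sum_congr rfl fun q hq => by rw [h q (mem_upSet.1 hq).1]]

theorem dsum_congr {r s : ℕ} {x y : ℤ × ℤ → ℝ} {p : ℤ × ℤ}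
    (h : ∀ q, CoverStep q p → x q = y q) : dsum r s x p = dsum r s y p := by
  unfold dsum
  rw [Finset.sum_congr rfl fun q hq => h q (mem_downSet.1 hq).1]

theorem usum_pos {r s : ℕ} {x : ℤ × ℤ → ℝ} (hx : ∀ p, inR r s p → 0 < x p) (p : ℤ × ℤ) :
    0 < usum r s x p := by
  unfold usum
  split_ifs with h
  · exact inv_pos.2 (Finset.sum_pos (fun q hq => inv_pos.2 (hx q (mem_upSet.1 hq).2)) h)
  · exact one_pos

theorem dsum_pos {r s : ℕ} {x : ℤ × ℤ → ℝ} (hx : ∀ p, inR r s p → 0 < x p) (p : ℤ × ℤ) :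
    0 < dsum r s x p := by
  unfold dsum
  split_ifs with h
  · exact Finset.sum_pos (fun q hq => hx q (mem_downSet.1 hq).2) h
  · exact one_pos

theorem toggle_pos {r s : ℕ} {x : ℤ × ℤ → ℝ} (hx : ∀ p, inR r s p → 0 < x p) (p : ℤ × ℤ) :
    ∀ q, inR r s q → 0 < toggle r s p x q := by
  intro q hq
  by_cases h : q = p
  · subst h
    rw [toggle_self]
    exact div_pos (mul_pos (usum_pos hx q) (dsum_pos hx q)) (hx q hq)
  · rw [toggle_of_ne r s h]
    exact hx q hq

theorem toggle_toggle {r s : ℕ} {x : ℤ × ℤ → ℝ} (hx : ∀ p, inR r s p → 0 < x p) {p : ℤ × ℤ}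
    (hp : inR r s p) : toggle r s p (toggle r s p x) = x := by
  funext q
  by_cases h : q = p
  · subst h
    rw [toggle_self, toggle_self, usum_congr (y := x) fun v hv => toggle_of_ne r s (CoverStep.ne hv).symm x,
      dsum_congr (y := x) fun v hv => toggle_of_ne r s (CoverStep.ne hv) x]
    have h₁ := usum_pos hx q
    have h₂ := dsum_pos hx q
    have h₃ := hx q hp
    field_simp
  · rw [toggle_of_ne r s h, toggle_of_ne r s h]

theorem foldl_toggle_pos {r s : ℕ} (l : List (ℤ × ℤ)) {x : ℤ × ℤ → ℝ}
    (hx : ∀ p, inR r s p → 0 < x p) :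
    ∀ q, inR r s q → 0 < l.foldl (fun y p => toggle r s p y) x q := by
  induction l generalizing x with
  | nil => exact hx
  | cons p l ih => exact ih (toggle_pos hx p)

theorem foldl_toggle_of_notMem {r s : ℕ} {l : List (ℤ × ℤ)} {q : ℤ × ℤ} (hq : q ∉ l)
    (x : ℤ × ℤ → ℝ) : l.foldl (fun y p => toggle r s p y) x q = x q := by
  induction l generalizing x with
  | nil => rfl
  | cons p l ih =>
    rw [List.mem_cons, not_or] at hq
    rw [List.foldl_cons, ih hq.2, toggle_of_ne r s hq.1]

theorem foldl_toggle_reverse {r s : ℕ} {l : List (ℤ × ℤ)} (hl : ∀ p ∈ l, inR r s p)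
    {x : ℤ × ℤ → ℝ} (hx : ∀ p, inR r s p → 0 < x p) :
    l.reverse.foldl (fun y p => toggle r s p y) (l.foldl (fun y p => toggle r s p y) x) = x := by
  induction l generalizing x with
  | nil => rfl
  | cons p l ih =>
    simp only [List.reverse_cons, List.foldl_append, List.foldl_cons, List.foldl_nil]
    rw [ih (fun q hq => hl q (List.mem_cons_of_mem p hq)) (toggle_pos hx p)]
    exact toggle_toggle hx (hl p List.mem_cons_self)

/-- Toggling along a list in which no element is preceded by one of its lower covers. -/
theorem foldl_toggle_apply {r s : ℕ} {l : List (ℤ × ℤ)}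
    (hl : l.Pairwise fun p q => p ≠ q ∧ ¬ CoverStep p q) {p : ℤ × ℤ} (hp : p ∈ l)
    (x : ℤ × ℤ → ℝ) :
    l.foldl (fun y p => toggle r s p y) x p =
      usum r s (l.foldl (fun y p => toggle r s p y) x) p * dsum r s x p / x p := by
  obtain ⟨l₁, l₂, rfl⟩ := List.append_of_mem hp
  rw [List.pairwise_append, List.pairwise_cons] at hl
  obtain ⟨-, ⟨hl₂, -⟩, hl₁⟩ := hl
  have hl₁ := fun q hq => hl₁ q hq p List.mem_cons_self
  simp only [List.foldl_append, List.foldl_cons]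
  rw [foldl_toggle_of_notMem (fun h => (hl₂ p h).1 rfl), toggle_self,
    foldl_toggle_of_notMem (fun h => (hl₁ p h).1 rfl),
    dsum_congr (x := l₁.foldl _ x) (y := x) fun q hq =>
      foldl_toggle_of_notMem (fun h => (hl₁ q h).2 hq) x]
  congr 2
  exact usum_congr fun q hq => by
    rw [foldl_toggle_of_notMem (fun h => (hl₂ q h).2 hq), toggle_of_ne r s (CoverStep.ne hq).symm]

theorem rectList_eq (a b : ℕ) : rectList a b =
    (List.range a).reverse.flatMap fun i : ℕ =>
      (List.range b).reverse.map fun j : ℕ => ((i : ℤ) + 1, (j : ℤ) + 1) := by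
  have hcast : ∀ l : List ℕ, (do let n ← l; pure (n : ℤ)) = l.map Nat.cast := fun l =>
    List.flatMap_pure_eq_map _ l
  rw [rectList, hcast, hcast, List.flatMap_map]
  simp only [List.map_map, Function.comp_def]

theorem mem_rectList {r s : ℕ} {p : ℤ × ℤ} : p ∈ rectList r s ↔ inR r s p := by
  obtain ⟨i, j⟩ := p
  simp only [rectList_eq, inR, List.mem_flatMap, List.mem_reverse, List.mem_range, List.mem_map,
    Prod.mk.injEq]
  constructor
  · rintro ⟨a, ha, b, hb, rfl, rfl⟩
    lia
  · rintro ⟨h₁, h₂, h₃, h₄⟩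
    exact ⟨(i - 1).toNat, by lia, (j - 1).toNat, by lia, by lia, by lia⟩

theorem pairwise_rectList (r s : ℕ) :
    (rectList r s).Pairwise fun p q => p ≠ q ∧ ¬ CoverStep p q := by
  have hdesc : (rectList r s).Pairwise fun p q => q.1 < p.1 ∨ q.1 = p.1 ∧ q.2 < p.2 := by
    rw [rectList_eq, List.pairwise_flatMap]
    refine ⟨fun a _ => ?_, ?_⟩
    · rw [List.pairwise_map, List.pairwise_reverse]
      exact List.pairwise_lt_range.imp fun h => Or.inr ⟨rfl, by simpa using h⟩
    · rw [List.pairwise_reverse]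
      refine List.pairwise_lt_range.imp fun {a b} h p hp q hq => Or.inl ?_
      obtain ⟨c, -, rfl⟩ := List.mem_map.1 hp
      obtain ⟨d, -, rfl⟩ := List.mem_map.1 hq
      simpa using h
  refine hdesc.imp fun {p q} h => ⟨?_, ?_⟩
  · rintro rfl
    lia
  · rintro (h' | h') <;> lia

theorem iterate_pos {r s : ℕ} {f : (ℤ × ℤ → ℝ) → ℤ × ℤ → ℝ}
    (hf : ∀ x, (∀ p, inR r s p → 0 < x p) → ∀ p, inR r s p → 0 < f x p) (n : ℕ)
    {x : ℤ × ℤ → ℝ} (hx : ∀ p, inR r s p → 0 < x p) : ∀ p, inR r s p → 0 < f^[n] x p := by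
  induction n generalizing x with
  | zero => exact hx
  | succ n ih => exact ih (hf x hx)

theorem rho_pos {r s : ℕ} {x : ℤ × ℤ → ℝ} (hx : ∀ p, inR r s p → 0 < x p) :
    ∀ p, inR r s p → 0 < rho r s x p := foldl_toggle_pos _ hx

theorem rhoInv_pos {r s : ℕ} {x : ℤ × ℤ → ℝ} (hx : ∀ p, inR r s p → 0 < x p) :
    ∀ p, inR r s p → 0 < rhoInv r s x p := foldl_toggle_pos _ hx

theorem rho_rhoInv {r s : ℕ} {x : ℤ × ℤ → ℝ} (hx : ∀ p, inR r s p → 0 < x p) :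
    rho r s (rhoInv r s x) = x := by
  have := foldl_toggle_reverse (l := (rectList r s).reverse)
    (fun p hp => mem_rectList.1 (List.mem_reverse.1 hp)) hx
  rwa [List.reverse_reverse] at this

theorem rho_apply {r s : ℕ} (x : ℤ × ℤ → ℝ) {p : ℤ × ℤ} (hp : inR r s p) :
    rho r s x p = usum r s (rho r s x) p * dsum r s x p / x p :=
  foldl_toggle_apply (pairwise_rectList r s) (mem_rectList.2 hp) x

theorem rhoPow_pos {r s : ℕ} {x : ℤ × ℤ → ℝ} (hx : ∀ p, inR r s p → 0 < x p) (k : ℤ) :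
    ∀ p, inR r s p → 0 < rhoPow r s k x p := by
  unfold rhoPow
  split_ifs
  · exact iterate_pos (fun _ => rho_pos) _ hx
  · exact iterate_pos (fun _ => rhoInv_pos) _ hx

theorem rhoPow_succ {r s : ℕ} {x : ℤ × ℤ → ℝ} (hx : ∀ p, inR r s p → 0 < x p) (k : ℤ) :
    rhoPow r s (k + 1) x = rho r s (rhoPow r s k x) := by
  rcases lt_or_ge k 0 with hk | hk
  · obtain ⟨n, rfl⟩ : ∃ n : ℕ, k = -(n + 1) := ⟨(-k - 1).toNat, by lia⟩
    have h₁ : rhoPow r s (-((n : ℤ) + 1)) x = rhoInv r s ((rhoInv r s)^[n] x) := by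
      rw [rhoPow, if_neg (by lia), ← Function.iterate_succ_apply' (rhoInv r s)]
      congr 2
    have h₂ : rhoPow r s (-((n : ℤ) + 1) + 1) x = (rhoInv r s)^[n] x := by
      rcases Nat.eq_zero_or_pos n with rfl | hn
      · rfl
      · rw [rhoPow, if_neg (by lia)]
        congr 2
        lia
    rw [h₁, h₂, rho_rhoInv]
    exact iterate_pos (fun _ => rhoInv_pos) _ hx
  · rw [rhoPow, rhoPow, if_pos (by lia), if_pos hk, ← Function.iterate_succ_apply' (rho r s)]
    congr 2
    lia

theorem ChainList.length_eq {a b : ℤ × ℤ} {l : List (ℤ × ℤ)} (hl : l.IsChain CoverStep)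
    (ha : l.head? = some a) (hb : l.getLast? = some b) :
    (l.length : ℤ) = b.1 + b.2 - a.1 - a.2 + 1 := by
  induction l generalizing a with
  | nil => simp at ha
  | cons c l ih =>
    obtain rfl : c = a := by simpa using ha
    cases l with
    | nil =>
      obtain rfl : c = b := by simpa using hb
      simp
    | cons d l =>
      rw [List.isChain_cons_cons] at hl
      have := ih hl.2 rfl (by simpa using hb)
      rw [List.length_cons]
      push_cast at this ⊢
      rcases hl.1 with h | h <;> lia

theorem ChainList.mem_bounds {a b : ℤ × ℤ} {l : List (ℤ × ℤ)} (hl : l.IsChain CoverStep)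
    (ha : l.head? = some a) (hb : l.getLast? = some b) :
    a ≤ b ∧ ∀ v ∈ l, a ≤ v ∧ v ≤ b := by
  induction l generalizing a with
  | nil => simp at ha
  | cons c l ih =>
    obtain rfl : c = a := by simpa using ha
    cases l with
    | nil =>
      obtain rfl : c = b := by simpa using hb
      simp
    | cons d l =>
      rw [List.isChain_cons_cons] at hl
      obtain ⟨h₁, h₂⟩ := ih hl.2 rfl (by simpa using hb)
      have hcd : c ≤ d := by rcases hl.1 with h | h <;> exact ⟨by lia, by lia⟩
      refine ⟨hcd.trans h₁, fun v hv => ?_⟩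
      rcases List.mem_cons.1 hv with rfl | hv
      · exact ⟨le_rfl, hcd.trans h₁⟩
      · exact ⟨hcd.trans (h₂ v hv).1, (h₂ v hv).2⟩

theorem finite_isChain_coverStep (n : ℕ) (a : ℤ × ℤ) :
    {l : List (ℤ × ℤ) | l.IsChain CoverStep ∧ l.head? = some a ∧ l.length ≤ n}.Finite := by
  induction n generalizing a with
  | zero =>
    refine Set.Finite.subset Set.finite_empty ?_
    rintro (_ | ⟨c, l⟩) ⟨-, h, h'⟩ <;> simp at h h'
  | succ n ih =>
    refine Set.Finite.subset ((Set.finite_singleton [a]).union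
      (((ih (a.1 + 1, a.2)).union (ih (a.1, a.2 + 1))).image (List.cons a))) ?_
    rintro (_ | ⟨c, _ | ⟨d, l⟩⟩) ⟨h₁, h₂, h₃⟩
    · simp at h₂
    · obtain rfl : c = a := by simpa using h₂
      simp
    · obtain rfl : c = a := by simpa using h₂
      rw [List.isChain_cons_cons] at h₁
      refine Or.inr ⟨d :: l, ?_, rfl⟩
      rcases h₁.1 with h | h
      · exact Or.inl ⟨h₁.2, by simp [Prod.ext_iff, h], by simpa using h₃⟩
      · exact Or.inr ⟨h₁.2, by simp [Prod.ext_iff, h], by simpa using h₃⟩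

instance (a b : ℤ × ℤ) : Finite (ChainList a b) := by
  refine Set.Finite.subset (finite_isChain_coverStep (b.1 + b.2 - a.1 - a.2 + 1).toNat a) ?_
  rintro l ⟨h₁, h₂, h₃⟩
  exact ⟨h₁, h₂, by have := ChainList.length_eq h₁ h₂ h₃; lia⟩

theorem ChainList.nonempty {a b : ℤ × ℤ} (hab : a ≤ b) : Nonempty (ChainList a b) := by
  obtain ⟨n, hn⟩ : ∃ n : ℕ, b.1 + b.2 - a.1 - a.2 = n :=
    ⟨(b.1 + b.2 - a.1 - a.2).toNat, by have := hab.1; have := hab.2; lia⟩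
  induction n generalizing a with
  | zero =>
    obtain rfl : a = b := by
      have := hab.1
      have := hab.2
      ext <;> lia
    exact ⟨[a], List.isChain_singleton a, rfl, rfl⟩
  | succ n ih =>
    obtain ⟨c, hac, hcb⟩ : ∃ c, CoverStep a c ∧ c ≤ b := by
      have := hab.1
      have := hab.2
      rcases lt_or_ge a.1 b.1 with h | h
      · exact ⟨(a.1 + 1, a.2), Or.inl ⟨rfl, rfl⟩, by constructor <;> simp <;> lia⟩
      · exact ⟨(a.1, a.2 + 1), Or.inr ⟨rfl, rfl⟩, by constructor <;> simp <;> lia⟩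
    obtain ⟨l, h₁, h₂, h₃⟩ := ih hcb (by push_cast at hn; rcases hac with h | h <;> lia)
    cases l with
    | nil => simp at h₂
    | cons d l =>
      obtain rfl : d = c := by simpa using h₂
      exact ⟨a :: d :: l, List.isChain_cons_cons.2 ⟨hac, h₁⟩, rfl, by simpa using h₃⟩

theorem phiInv_pos {r s : ℕ} {x : ℤ × ℤ → ℝ} (hx : ∀ p, inR r s p → 0 < x p) :
    ∀ p, inR r s p → 0 < phiInv x p := by
  intro p hp
  have : Nonempty (ChainList (1, 1) p) := ChainList.nonempty ⟨hp.1, hp.2.2.1⟩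
  have hpos : ∀ c : ChainList (1, 1) p, 0 < (c.1.map x).prod := by
    rintro ⟨l, h₁, h₂, h₃⟩
    refine List.prod_pos fun w hw => ?_
    obtain ⟨v, hv, rfl⟩ := List.mem_map.1 hw
    obtain ⟨h₄, h₅⟩ := (ChainList.mem_bounds h₁ h₂ h₃).2 v hv
    exact hx v ⟨h₄.1, h₅.1.trans hp.2.1, h₄.2, h₅.2.trans hp.2.2.2⟩
  exact finsum_pos (fun c => (hpos c).le) ⟨Classical.arbitrary _, hpos _⟩ (Set.toFinite _)

/-- A labeling extended to a border of the rectangle, with value `1` at `(1, 0)`, which plays the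
role of a minimum adjoined to the poset. -/
noncomputable def lowerExt (r s : ℕ) (x : ℤ × ℤ → ℝ) (m j : ℕ) : ℝ :=
  if inR r s (m, j) then x (m, j) else if m = 1 ∧ j = 0 then 1 else 0

/-- The inverse of a labeling extended to a border of the rectangle, with value `1` at
`(r, s + 1)`, which plays the role of a maximum adjoined to the poset. -/
noncomputable def upperExt (r s : ℕ) (x : ℤ × ℤ → ℝ) (m j : ℕ) : ℝ :=
  if inR r s (m, j) then (x (m, j))⁻¹ else if m = r ∧ j = s + 1 then 1 else 0

theorem dsum_eq_lowerExt {r s : ℕ} (x : ℤ × ℤ → ℝ) {m j : ℕ} (hm : m < r) (hj : j < s) :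
    dsum r s x ((m + 1 : ℕ), (j + 1 : ℕ)) = lowerExt r s x m (j + 1) + lowerExt r s x (m + 1) j := by
  have h₁ : inR r s ((m : ℤ), ((j + 1 : ℕ) : ℤ)) ↔ 1 ≤ m := by simp [inR]; lia
  have h₂ : inR r s (((m + 1 : ℕ) : ℤ), (j : ℤ)) ↔ 1 ≤ j := by simp [inR]; lia
  unfold dsum downSet lowerExt
  rw [Finset.filter_insert, Finset.filter_singleton]
  simp only [h₁, h₂, show ((m + 1 : ℕ) : ℤ) - 1 = m by lia, show ((j + 1 : ℕ) : ℤ) - 1 = j by lia]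
  rcases Nat.eq_zero_or_pos m with rfl | hm' <;> rcases Nat.eq_zero_or_pos j with rfl | hj'
  · simp
  · simp [Nat.one_le_iff_ne_zero, hj'.ne']
  · simp [Nat.one_le_iff_ne_zero, hm'.ne']
  · have h₁ : 1 ≤ m := hm'
    have h₂ : 1 ≤ j := hj'
    simp only [h₁, h₂, if_true]
    rw [if_pos (Finset.insert_nonempty _ _), Finset.sum_pair (by simp)]

theorem inv_usum_eq_upperExt {r s : ℕ} (x : ℤ × ℤ → ℝ) {m j : ℕ} (hm : m < r) (hj : j < s) :
    (usum r s x ((m + 1 : ℕ), (j + 1 : ℕ)))⁻¹ =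
      upperExt r s x (m + 2) (j + 1) + upperExt r s x (m + 1) (j + 2) := by
  have h₁ : inR r s (((m + 2 : ℕ) : ℤ), ((j + 1 : ℕ) : ℤ)) ↔ m + 2 ≤ r := by simp [inR]; lia
  have h₂ : inR r s (((m + 1 : ℕ) : ℤ), ((j + 2 : ℕ) : ℤ)) ↔ j + 2 ≤ s := by simp [inR]; lia
  unfold usum upSet upperExt
  rw [Finset.filter_insert, Finset.filter_singleton]
  simp only [h₁, h₂, show ((m + 1 : ℕ) : ℤ) + 1 = (m + 2 : ℕ) by lia,
    show ((j + 1 : ℕ) : ℤ) + 1 = (j + 2 : ℕ) by lia]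
  by_cases hm' : m + 2 ≤ r <;> by_cases hj' : j + 2 ≤ s
  · simp only [hm', hj', if_true]
    rw [if_pos (Finset.insert_nonempty _ _), Finset.sum_pair (by simp), inv_inv]
  · have : m + 1 ≠ r := by lia
    simp [hm', hj', this]
  · have : j ≠ s := by lia
    simp [hm', hj', this]
  · obtain rfl : r = m + 1 := by lia
    obtain rfl : s = j + 1 := by lia
    simp

theorem rowmotionOrbit_rhoPow {r s : ℕ} {x : ℤ × ℤ → ℝ} (hx : ∀ p, inR r s p → 0 < x p) :
    RowmotionOrbit r s (fun t => lowerExt r s (rhoPow r s t x))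
      (fun t => upperExt r s (rhoPow r s t x)) where
  pos t m j h₁ h₂ h₃ h₄ := by
    have h : inR r s ((m : ℤ), (j : ℤ)) := by simp [inR]; lia
    simpa only [lowerExt, if_pos h] using rhoPow_pos hx t _ h
  mul_eq_one t m j h₁ h₂ h₃ h₄ := by
    have h : inR r s ((m : ℤ), (j : ℤ)) := by simp [inR]; lia
    simp only [lowerExt, upperExt, if_pos h]
    exact mul_inv_cancel₀ (rhoPow_pos hx t _ h).ne'
  lower_row t j := by simp [lowerExt, inR]
  lower_col t m := by simp [lowerExt, inR]
  upper_row t j := by simp [upperExt, inR]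
  upper_col t m := by simp [upperExt, inR]
  step t m j hm hj := by
    have h : inR r s (((m + 1 : ℕ) : ℤ), ((j + 1 : ℕ) : ℤ)) := by simp [inR]; lia
    have h₁ := rho_apply (rhoPow r s t x) h
    rw [← rhoPow_succ hx] at h₁
    have h₂ := usum_pos (rhoPow_pos hx (t + 1)) ((m + 1 : ℕ), (j + 1 : ℕ))
    rw [← inv_usum_eq_upperExt _ hm hj, ← dsum_eq_lowerExt _ hm hj, lowerExt, upperExt, if_pos h,
      if_pos h, h₁]
    field_simp

/-- **Theorem 3.6(b).** Let `y = φ⁻¹(x)` and `(i,j) ∈ R = [r] × [s]`. For every integer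
`k`, `ρ^{k}(y)_{ij} ⋅ ρ^{k-i-j+1}(y)_{r+1-i, s+1-j} = 1`. -/
theorem rowmotion_antipodal (r s : ℕ) (hr : 1 ≤ r) (hs : 1 ≤ s)
    (x : ℤ × ℤ → ℝ) (hx : ∀ p, inR r s p → 0 < x p)
    (i j : ℤ) (hij : inR r s (i, j)) (k : ℤ) :
    rhoPow r s k (phiInv x) (i, j) *
      rhoPow r s (k - i - j + 1) (phiInv x) ((r : ℤ) + 1 - i, (s : ℤ) + 1 - j) = 1 := by
  obtain ⟨h₁, h₂, h₃, h₄⟩ := id hij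
  simp only at h₁ h₂ h₃ h₄
  lift i to ℕ using by lia
  lift j to ℕ using by lia
  have h := (rowmotionOrbit_rhoPow (phiInv_pos hx)).reciprocity i j (r + 1 - i) (s + 1 - j)
    (by lia) (by lia) (by lia) (by lia) (by lia) (by lia) (k - i - j + 1) k (by lia)
  have hij' : inR r s (((r + 1 - i : ℕ) : ℤ), ((s + 1 - j : ℕ) : ℤ)) := by simp [inR]; lia
  simp only [lowerExt, if_pos hij, if_pos hij'] at h
  convert h using 4 <;> lia

end Paper
end

section
/- Let P be a finite poset. Then for every x ∈ ℝ_{>0}^P and every p ∈ P, ρ(φ⁻¹(x))_p · (φ*)⁻¹(x)_p = 1, i.e., the p-coordinate of birational rowmotion applied to φ⁻¹(x) is the reciprocal of the p-coordinate of (φ*)⁻¹(x). -/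
namespace Paper

open Classical in
/-- The birational toggle at `p` in a finite poset `P`: the `p`-coordinate becomes
`(∑^∥_{q ⋗ p} x_q) (∑_{q ⋖ p} x_q) / x_p`, where `∥` is the parallel sum and an empty
sum or parallel sum is interpreted as `1`. -/
noncomputable def ptoggle {P : Type*} [PartialOrder P] [Fintype P] (p : P)
    (x : P → ℝ) : P → ℝ :=
  fun q => if q = p then
    (if {q' | p ⋖ q'}.Nonempty then
        (∑ q' ∈ (Set.toFinite {q' | p ⋖ q'}).toFinset, (x q')⁻¹)⁻¹ else 1) *
    (if {q' | q' ⋖ p}.Nonempty then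
        ∑ q' ∈ (Set.toFinite {q' | q' ⋖ p}).toFinset, x q' else 1) / x p
  else x q

/-- The inverse birational transfer map `φ⁻¹`: the `p`-coordinate is the sum, over all
saturated chains `c₁ ⋖ c₂ ⋖ ⋯ ⋖ c_m = p` with `c₁` minimal, of `x_{c₁} ⋯ x_{c_m}`. -/
noncomputable def phiInvP {P : Type*} [PartialOrder P] (x : P → ℝ) (p : P) : ℝ :=
  ∑ᶠ c : {l : List P // l.Chain' (· ⋖ ·) ∧ (∃ a, l.head? = some a ∧ IsMin a) ∧
      l.getLast? = some p},
    (c.1.map x).prod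

/-- The inverse dual transfer map `(φ*)⁻¹`: the `p`-coordinate is the sum, over all
saturated chains `p = c₁ ⋖ c₂ ⋖ ⋯ ⋖ c_m` with `c_m` maximal, of `x_{c₁} ⋯ x_{c_m}`. -/
noncomputable def phiStarInvP {P : Type*} [PartialOrder P] (x : P → ℝ) (p : P) : ℝ :=
  ∑ᶠ c : {l : List P // l.Chain' (· ⋖ ·) ∧ l.head? = some p ∧
      (∃ a, l.getLast? = some a ∧ IsMax a)},
    (c.1.map x).prod

/-- The lists forming an `r`-chain that starts at `p` and ends at an `r`-terminal element. -/
def terminalChains {P : Type*} (r : P → P → Prop) (p : P) : Set (List P) :=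
  {l | l.IsChain r ∧ l.head? = some p ∧ ∃ a, l.getLast? = some a ∧ ∀ b, ¬ r a b}

/-- The sum of the weights `x_{c₁} ⋯ x_{c_m}` over all chains in `terminalChains r p`. -/
noncomputable def terminalChainSum {P : Type*} (r : P → P → Prop) (x : P → ℝ) (p : P) : ℝ :=
  ∑ᶠ l ∈ terminalChains r p, (l.map x).prod

section TerminalChains

variable {P : Type*} {r : P → P → Prop}

lemma terminalChains_of_terminal {p : P} (h : ∀ b, ¬ r p b) : terminalChains r p = {[p]} := by
  ext l
  rcases l with _ | ⟨a, _ | ⟨b, t⟩⟩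
  · simp [terminalChains]
  · simp only [terminalChains, Set.mem_ofPred_eq, Set.mem_singleton_iff]
    constructor
    · rintro ⟨-, h1, -⟩
      simpa using h1
    · intro h1
      obtain rfl : a = p := by simpa using h1
      simpa using h
  · simp only [terminalChains, Set.mem_ofPred_eq, Set.mem_singleton_iff, List.isChain_cons_cons,
      List.head?_cons, Option.some.injEq]
    constructor
    · rintro ⟨⟨h1, -⟩, rfl, -⟩
      exact absurd h1 (h b)
    · intro h1
      simp at h1

lemma terminalChains_of_not_terminal {p : P} (h : ∃ b, r p b) :
    terminalChains r p = ⋃ q ∈ {q | r p q}, List.cons p '' terminalChains r q := by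
  ext l
  simp only [terminalChains, Set.mem_iUnion, Set.mem_image, Set.mem_ofPred_eq, exists_prop]
  constructor
  · rintro ⟨hc, hh, a, ha, hmax⟩
    rcases l with _ | ⟨c, _ | ⟨b, t⟩⟩
    · simp at hh
    · obtain rfl : c = p := by simpa using hh
      obtain rfl : c = a := by simpa using ha
      obtain ⟨b, hb⟩ := h
      exact absurd hb (hmax b)
    · obtain rfl : c = p := by simpa using hh
      rw [List.isChain_cons_cons] at hc
      exact ⟨b, hc.1, b :: t, ⟨hc.2, rfl, a, by simpa using ha, hmax⟩, rfl⟩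
  · rintro ⟨q, hq, t, ⟨hc, hh, a, ha, hmax⟩, rfl⟩
    rcases t with _ | ⟨b, t⟩
    · simp at hh
    · obtain rfl : b = q := by simpa using hh
      exact ⟨List.isChain_cons_cons.2 ⟨hq, hc⟩, rfl, a, by simpa using ha, hmax⟩

lemma finite_terminalChains [Finite P] (hr : WellFounded (flip r)) (p : P) :
    (terminalChains r p).Finite := by
  induction p using hr.induction with
  | _ p ih =>
    by_cases h : ∃ b, r p b
    · rw [terminalChains_of_not_terminal h]
      exact (Set.toFinite _).biUnion fun q hq => (ih q hq).image _
    · rw [terminalChains_of_terminal (not_exists.1 h)]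
      exact Set.finite_singleton _

lemma terminalChainSum_of_terminal (x : P → ℝ) {p : P} (h : ∀ b, ¬ r p b) :
    terminalChainSum r x p = x p := by
  simp [terminalChainSum, terminalChains_of_terminal h]

lemma terminalChainSum_of_not_terminal [Finite P] (hr : WellFounded (flip r)) (x : P → ℝ)
    {p : P} (h : ∃ b, r p b) :
    terminalChainSum r x p =
      x p * ∑ q ∈ (Set.toFinite {q | r p q}).toFinset, terminalChainSum r x q := by
  have hdisj : ({q | r p q}).PairwiseDisjoint fun q => List.cons p '' terminalChains r q := by
    intro q _ q' _ hne
    rw [Function.onFun, Set.disjoint_left]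
    rintro _ ⟨t, ht, rfl⟩ ⟨t', ht', he⟩
    obtain rfl : t' = t := by simpa using he
    exact hne (Option.some.inj (ht.2.1.symm.trans ht'.2.1))
  rw [terminalChainSum, terminalChains_of_not_terminal h,
    finsum_mem_biUnion hdisj (Set.toFinite _)
      fun q _ => (finite_terminalChains hr q).image _,
    finsum_mem_eq_finite_toFinset_sum _ (Set.toFinite _), Finset.mul_sum]
  refine Finset.sum_congr rfl fun q _ => ?_
  rw [finsum_mem_image (List.cons_injective.injOn), terminalChainSum,
    mul_finsum_mem]
  simp

lemma terminalChainSum_pos [Finite P] (hr : WellFounded (flip r)) {x : P → ℝ}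
    (hx : ∀ p, 0 < x p) (p : P) : 0 < terminalChainSum r x p := by
  induction p using hr.induction with
  | _ p ih =>
    by_cases h : ∃ b, r p b
    · rw [terminalChainSum_of_not_terminal hr x h]
      refine mul_pos (hx p) (Finset.sum_pos (fun q hq => ih q (by simpa [flip] using hq)) ?_)
      simpa using (show ({q | r p q}).Nonempty from h)
    · rw [terminalChainSum_of_terminal x (not_exists.1 h)]
      exact hx p

end TerminalChains

section Poset

variable {P : Type*} [PartialOrder P]

lemma isMax_iff_forall_not_covBy [Finite P] {a : P} : IsMax a ↔ ∀ b, ¬ a ⋖ b :=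
  ⟨fun h _ hb => h.not_lt hb.lt, fun h => by
    by_contra hm
    obtain ⟨b, hb⟩ := exists_covBy_of_wellFoundedLT hm
    exact h b hb⟩

lemma isMin_iff_forall_not_covBy [Finite P] {a : P} : IsMin a ↔ ∀ b, ¬ b ⋖ a :=
  ⟨fun h _ hb => h.not_lt hb.lt, fun h => by
    by_contra hm
    obtain ⟨b, hb⟩ := exists_covBy_of_wellFoundedGT hm
    exact h b hb⟩

lemma wellFounded_covBy [Finite P] : WellFounded (fun a b : P => a ⋖ b) :=
  Subrelation.wf (fun h => CovBy.lt h) wellFounded_lt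

lemma wellFounded_flip_covBy [Finite P] : WellFounded (flip fun a b : P => a ⋖ b) :=
  Subrelation.wf (r := fun a b : P => a > b) (fun h => CovBy.lt h) wellFounded_gt

lemma phiStarInvP_eq_terminalChainSum [Finite P] (x : P → ℝ) (p : P) :
    phiStarInvP x p = terminalChainSum (· ⋖ ·) x p := by
  rw [terminalChainSum, ← finsum_set_coe_eq_finsum_mem]
  refine finsum_eq_of_bijective (Equiv.subtypeEquivRight fun l => ?_) (Equiv.bijective _)
    fun _ => rfl
  simp only [terminalChains, Set.mem_ofPred_eq, isMax_iff_forall_not_covBy]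
  exact Iff.rfl

lemma phiInvP_eq_terminalChainSum [Finite P] (x : P → ℝ) (p : P) :
    phiInvP x p = terminalChainSum (flip (· ⋖ ·)) x p := by
  rw [terminalChainSum, ← finsum_set_coe_eq_finsum_mem]
  refine finsum_eq_of_bijective
    ((List.reverse_involutive.toPerm List.reverse).subtypeEquiv fun l => ?_) (Equiv.bijective _)
    fun l => ?_
  · simp only [terminalChains, Set.mem_ofPred_eq, isMin_iff_forall_not_covBy,
      Function.Involutive.coe_toPerm, List.isChain_reverse, List.head?_reverse,
      List.getLast?_reverse, flip]
    tauto
  · simp [List.prod_reverse]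

lemma phiInvP_pos [Finite P] {x : P → ℝ} (hx : ∀ p, 0 < x p) (p : P) : 0 < phiInvP x p := by
  rw [phiInvP_eq_terminalChainSum]
  exact terminalChainSum_pos wellFounded_covBy hx p

lemma phiStarInvP_pos [Finite P] {x : P → ℝ} (hx : ∀ p, 0 < x p) (p : P) :
    0 < phiStarInvP x p := by
  rw [phiStarInvP_eq_terminalChainSum]
  exact terminalChainSum_pos wellFounded_flip_covBy hx p

open Classical in
lemma phiInvP_eq_mul [Finite P] (x : P → ℝ) (p : P) :
    phiInvP x p = x p * if {q | q ⋖ p}.Nonempty then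
      ∑ q ∈ (Set.toFinite {q | q ⋖ p}).toFinset, phiInvP x q else 1 := by
  simp only [phiInvP_eq_terminalChainSum]
  split_ifs with h
  · exact terminalChainSum_of_not_terminal wellFounded_covBy x h
  · rw [mul_one]
    exact terminalChainSum_of_terminal x fun b hb => h ⟨b, hb⟩

open Classical in
lemma phiStarInvP_eq_mul [Finite P] (x : P → ℝ) (p : P) :
    phiStarInvP x p = x p * if {q | p ⋖ q}.Nonempty then
      ∑ q ∈ (Set.toFinite {q | p ⋖ q}).toFinset, phiStarInvP x q else 1 := by
  simp only [phiStarInvP_eq_terminalChainSum]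
  split_ifs with h
  · exact terminalChainSum_of_not_terminal wellFounded_flip_covBy x h
  · rw [mul_one]
    exact terminalChainSum_of_terminal x fun b hb => h ⟨b, hb⟩

lemma ptoggle_of_ne [Fintype P] {p q : P} (h : q ≠ p) (y : P → ℝ) : ptoggle p y q = y q :=
  if_neg h

/-- Toggling at `p` when the upper covers of `p` already carry the reciprocal of `φ*⁻¹` while
`p` and its lower covers still carry `φ⁻¹`. -/
lemma ptoggle_self_eq_inv [Fintype P] {x : P → ℝ} (hx : ∀ p, 0 < x p) {p : P} {y : P → ℝ}
    (hup : ∀ q, p ⋖ q → y q = (phiStarInvP x q)⁻¹) (hlow : ∀ q, q ⋖ p → y q = phiInvP x q)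
    (hp : y p = phiInvP x p) : ptoggle p y p = (phiStarInvP x p)⁻¹ := by
  have hpos := phiInvP_pos hx p
  have hxp := hx p
  rw [ptoggle, if_pos rfl, hp,
    Finset.sum_congr rfl fun q hq => show (y q)⁻¹ = phiStarInvP x q by
      rw [hup q (by simpa using hq), inv_inv],
    Finset.sum_congr rfl fun q hq => hlow q (by simpa using hq), phiStarInvP_eq_mul]
  rw [phiInvP_eq_mul] at hpos ⊢
  have hne := (pos_of_mul_pos_right hpos hxp.le).ne'
  split_ifs at hne ⊢ <;> field_simp

lemma foldl_ptoggle_phiInvP [Fintype P] {x : P → ℝ} (hx : ∀ p, 0 < x p) (l : List P)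
    (hnodup : l.Nodup) (hdesc : l.Pairwise fun a b => ¬ a < b)
    (hupper : ∀ a ∈ l, ∀ b, a < b → b ∈ l) :
    (∀ p ∈ l, l.foldl (fun y q => ptoggle q y) (phiInvP x) p = (phiStarInvP x p)⁻¹) ∧
      ∀ p ∉ l, l.foldl (fun y q => ptoggle q y) (phiInvP x) p = phiInvP x p := by
  induction l using List.reverseRecOn with
  | nil => simp
  | append_singleton l c ih =>
    rw [List.nodup_append] at hnodup
    rw [List.pairwise_append] at hdesc
    have hc : c ∉ l := fun h => hnodup.2.2 c h c (by simp) rfl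
    obtain ⟨ih1, ih2⟩ := ih hnodup.1 hdesc.1 fun a ha b hab => by
      rcases List.mem_append.1 (hupper a (by simp [ha]) b hab) with h | h
      · exact h
      · exact absurd (List.mem_singleton.1 h ▸ hab) (hdesc.2.2 a ha c (by simp))
    simp only [List.foldl_append, List.foldl_cons, List.foldl_nil]
    refine ⟨fun p hp => ?_, fun p hp => ?_⟩
    · by_cases hpc : p = c
      · subst hpc
        refine ptoggle_self_eq_inv hx (fun q hq => ih1 q ?_) (fun q hq => ih2 q fun h => ?_)
          (ih2 p hc)
        · rcases List.mem_append.1 (hupper p (by simp) q hq.lt) with h | h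
          · exact h
          · exact absurd (List.mem_singleton.1 h) hq.lt.ne'
        · exact hdesc.2.2 q h p (by simp) hq.lt
      · rw [ptoggle_of_ne hpc]
        exact ih1 p (by simpa [hpc] using hp)
    · have hpc : p ∉ l ∧ p ≠ c := by simpa using hp
      rw [ptoggle_of_ne hpc.2]
      exact ih2 p hpc.1

end Poset

/-- For any finite poset `P`, any `x ∈ ℝ_{>0}^P` and any `p ∈ P`,
`ρ(φ⁻¹(x))_p ⋅ (φ*)⁻¹(x)_p = 1`, where birational rowmotion `ρ` is the composition of
all toggles along (the reverse of) any linear extension, i.e. from top to bottom. -/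
theorem rho_phiInv_eq_inv_phiStarInv {P : Type*} [PartialOrder P] [Fintype P]
    (x : P → ℝ) (hx : ∀ p, 0 < x p)
    (l : List P) (hnodup : l.Nodup) (hmem : ∀ p : P, p ∈ l)
    (hdesc : l.Pairwise fun a b => ¬ a < b) (p : P) :
    l.foldl (fun y q => ptoggle q y) (phiInvP x) p * phiStarInvP x p = 1 := by
  rw [(foldl_ptoggle_phiInvP hx l hnodup hdesc fun _ _ b _ => hmem b).1 p (hmem p)]
  exact inv_mul_cancel₀ (phiStarInvP_pos hx p).ne'

end Paper
end
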